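/- For any two $k$-element subsets $I,J \subseteq \{1,\dots,n\}$ with $|I \cap J| = \ell$, one has $(v_I, v_J) = (v_I, V_J) = a_\ell$, where $a_\ell = (-1)^{k+\ell}\,(n-2k+1)\,(k-\ell)!\,(n-2k+\ell)!/(n-k+1)!$. -/

import Mathlib

noncomputable section

/-- The `sl₂`-module `W^{⊗n}`, `W = ℂ²`, identified with the free complex vector space
on the set of subsets of `{1,…,n}`. -/
abbrev WT (n : ℕ) := Finset (Fin n) →₀ ℂ

/-- Build a linear operator on `WT n` from its values on the basis vectors `V_I`. -/
def mkOp {n : ℕ} (φ : Finset (Fin n) → WT n) : WT n →ₗ[ℂ] WT n :=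
  Finsupp.lsum ℂ fun I => LinearMap.toSpanSingleton ℂ (WT n) (φ I)

/-- Diagonal action of `e`: `e V_I = ∑_{i ∈ I} V_{I∖{i}}`. -/
def opE (n : ℕ) : WT n →ₗ[ℂ] WT n :=
  mkOp fun I => ∑ i ∈ I, Finsupp.single (I.erase i) 1

/-- Diagonal action of `f`: `f V_I = ∑_{i ∉ I} V_{I∪{i}}`. -/
def opF (n : ℕ) : WT n →ₗ[ℂ] WT n :=
  mkOp fun I => ∑ i ∈ Iᶜ, Finsupp.single (insert i I) 1

/-- Diagonal action of `h`: `h V_I = (n - 2|I|) V_I`. -/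
def opH (n : ℕ) : WT n →ₗ[ℂ] WT n :=
  mkOp fun I => ((n : ℂ) - 2 * I.card) • Finsupp.single I 1

/-- The Shapovalov form: the symmetric bilinear form with `(V_I, V_J) = δ_{IJ}`. -/
def shap {n : ℕ} (x y : WT n) : ℂ := x.sum fun I c => c * y I

/-- The weight space `W^{⊗n}[n-2k]`, spanned by the `V_I` with `|I| = k`. -/
def weight (n k : ℕ) : Submodule ℂ (WT n) :=
  Submodule.span ℂ {x | ∃ I : Finset (Fin n), I.card = k ∧ x = Finsupp.single I 1}

/-- The space of singular vectors `Sing W^{⊗n}[n-2k] = {w ∈ W^{⊗n}[n-2k] : e w = 0}`. -/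
def sing (n k : ℕ) : Submodule ℂ (WT n) :=
  weight n k ⊓ LinearMap.ker (opE n)

/-- `b_ℓ = (-1)^{k-ℓ} (k-ℓ-1)! (n-2k+ℓ+1)! / (n-k+1)!`. -/
def bCoef (n k ℓ : ℕ) : ℂ :=
  (-1) ^ (k - ℓ) * ((k - ℓ - 1).factorial : ℂ) * ((n - 2 * k + ℓ + 1).factorial : ℂ) /
    ((n - k + 1).factorial : ℂ)

/-- `a_ℓ = (-1)^{k+ℓ} (n-2k+1) (k-ℓ)! (n-2k+ℓ)! / (n-k+1)!`. -/
def aCoef (n k ℓ : ℕ) : ℂ :=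
  (-1) ^ (k + ℓ) * ((n - 2 * k + 1 : ℕ) : ℂ) * ((k - ℓ).factorial : ℂ) *
    ((n - 2 * k + ℓ).factorial : ℂ) / ((n - k + 1).factorial : ℂ)

theorem shap_eq_sum {n : ℕ} (x y : WT n) : shap x y = ∑ L, x L * y L :=
  Finsupp.sum_fintype _ _ fun _ => zero_mul _

theorem shap_comm {n : ℕ} (x y : WT n) : shap x y = shap y x := by
  simp only [shap_eq_sum, mul_comm]

theorem shap_sub_left {n : ℕ} (x y z : WT n) : shap (x - y) z = shap x z - shap y z := by
  simp [shap_eq_sum, sub_mul, Finset.sum_sub_distrib]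

theorem shap_single_left {n : ℕ} (I : Finset (Fin n)) (y : WT n) :
    shap (Finsupp.single I 1) y = y I := by
  simp [shap]

theorem opE_single {n : ℕ} (I : Finset (Fin n)) (c : ℂ) :
    opE n (Finsupp.single I c) = ∑ i ∈ I, Finsupp.single (I.erase i) c := by
  simp [opE, mkOp, Finset.smul_sum]

theorem opE_apply {n : ℕ} (x : WT n) (K : Finset (Fin n)) :
    opE n x K = ∑ i ∈ Kᶜ, x (insert i K) := by
  induction x using Finsupp.induction_linear with
  | zero => simp
  | add x y hx hy => simp [hx, hy, Finset.sum_add_distrib]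
  | single I c =>
    rw [opE_single, Finsupp.finsetSum_apply]
    simp only [Finsupp.single_apply, ← Finset.sum_filter]
    congr 1
    ext i
    simp only [Finset.mem_filter, Finset.mem_compl]
    constructor
    · rintro ⟨hi, rfl⟩
      simp [Finset.insert_erase hi]
    · rintro ⟨hi, rfl⟩
      simp [Finset.erase_insert hi]

theorem single_mem_weight {n k : ℕ} {I : Finset (Fin n)} (hI : I.card = k) :
    Finsupp.single I 1 ∈ weight n k :=
  Submodule.subset_span ⟨I, hI, rfl⟩

/-- Summing a function of `|J ∩ (K ∪ {i})|` over `i ∉ K`. -/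
theorem sum_card_inter_insert {n : ℕ} (J K : Finset (Fin n)) (g : ℕ → ℂ) :
    ∑ i ∈ Kᶜ, g (J ∩ insert i K).card =
      (J \ K).card * g ((J ∩ K).card + 1) + (J ∪ K)ᶜ.card * g (J ∩ K).card := by
  rw [← Finset.sum_filter_add_sum_filter_not Kᶜ (· ∈ J)]
  congr 1
  · have hfilter : Kᶜ.filter (· ∈ J) = J \ K := by ext; simp [and_comm]
    rw [hfilter, ← nsmul_eq_mul]
    refine Finset.sum_eq_card_nsmul fun i hi => ?_
    rw [Finset.mem_sdiff] at hi
    rw [Finset.inter_insert_of_mem hi.1, Finset.card_insert_of_notMem (by simp [hi.2])]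
  · have hfilter : Kᶜ.filter (· ∉ J) = (J ∪ K)ᶜ := by ext; simp [and_comm]
    rw [hfilter, ← nsmul_eq_mul]
    refine Finset.sum_eq_card_nsmul fun i hi => ?_
    rw [Finset.mem_compl, Finset.mem_union, not_or] at hi
    rw [Finset.inter_insert_of_notMem hi.1]

/-- Summing a function of `|J ∩ (L ∖ {i})|` over `i ∈ L`. -/
theorem sum_card_inter_erase {n : ℕ} (J L : Finset (Fin n)) (g : ℕ → ℂ) :
    ∑ i ∈ L, g (J ∩ L.erase i).card =
      (J ∩ L).card * g ((J ∩ L).card - 1) + (L \ J).card * g (J ∩ L).card := by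
  rw [← Finset.sum_filter_add_sum_filter_not L (· ∈ J)]
  congr 1
  · have hfilter : L.filter (· ∈ J) = J ∩ L := by ext; simp [and_comm]
    rw [hfilter, ← nsmul_eq_mul]
    refine Finset.sum_eq_card_nsmul fun i hi => ?_
    rw [Finset.inter_erase, Finset.card_erase_of_mem hi]
  · have hfilter : L.filter (· ∉ J) = L \ J := by ext; simp
    rw [hfilter, ← nsmul_eq_mul]
    refine Finset.sum_eq_card_nsmul fun i hi => ?_
    rw [Finset.mem_sdiff] at hi
    rw [Finset.inter_erase, Finset.erase_eq_of_notMem (by simp [hi.2])]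

theorem aCoef_recurrence {n k m : ℕ} (hn : 2 * k ≤ n) (hm : m < k) :
    ((k - m : ℕ) : ℂ) * aCoef n k (m + 1) + ((n - 2 * k + m + 1 : ℕ) : ℂ) * aCoef n k m = 0 := by
  obtain ⟨d, rfl⟩ := Nat.exists_eq_add_of_lt hm
  obtain ⟨N, rfl⟩ := Nat.exists_eq_add_of_le hn
  have h₁ : m + d + 1 - m = d + 1 := by omega
  have h₂ : m + d + 1 - (m + 1) = d := by omega
  have h₃ : 2 * (m + d + 1) + N - 2 * (m + d + 1) = N := by omega
  simp only [aCoef, h₁, h₂, h₃, ← add_assoc, Nat.factorial_succ, pow_succ]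
  push_cast
  ring

theorem bCoef_recurrence {n k m : ℕ} (hn : 2 * k ≤ n) (hm : m < k) :
    (m : ℂ) * bCoef n k (m - 1) + ((k - m : ℕ) : ℂ) * bCoef n k m = aCoef n k m := by
  obtain ⟨d, rfl⟩ := Nat.exists_eq_add_of_lt hm
  obtain ⟨N, rfl⟩ := Nat.exists_eq_add_of_le hn
  have hsign : (-1 : ℂ) ^ (m + d + 1 + m) = (-1) ^ (d + 1) := by
    rw [show m + d + 1 + m = 2 * m + (d + 1) by ring, pow_add, pow_mul]
    simp
  have h₁ : m + d + 1 - m = d + 1 := by omega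
  have h₃ : 2 * (m + d + 1) + N - 2 * (m + d + 1) = N := by omega
  rcases m with _ | p
  · simp only [aCoef, bCoef, h₁, h₃, hsign, Nat.factorial_succ, Nat.add_sub_cancel, add_zero]
    push_cast
    ring
  · have h₄ : p + 1 + d + 1 - p = d + 2 := by omega
    have h₅ : d + 2 - 1 = d + 1 := by omega
    rw [aCoef, hsign]
    simp only [bCoef, h₁, h₃, h₄, h₅, Nat.add_sub_cancel, ← add_assoc,
      Nat.factorial_succ, pow_succ]
    push_cast
    ring

theorem bCoef_pred {n k : ℕ} (hk : 1 ≤ k) (hn : 2 * k ≤ n) :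
    (k : ℂ) * bCoef n k (k - 1) = aCoef n k k - 1 := by
  obtain ⟨p, rfl⟩ := Nat.exists_eq_add_of_le hk
  obtain ⟨N, rfl⟩ := Nat.exists_eq_add_of_le hn
  have h₁ : 1 + p - (1 + p - 1) = 1 := by omega
  have h₂ : 2 * (1 + p) + N - 2 * (1 + p) = N := by omega
  have h₃ : N + (1 + p - 1) + 1 = N + (1 + p) := by omega
  have h₄ : 2 * (1 + p) + N - (1 + p) = N + (1 + p) := by omega
  have hfac : ((N + (1 + p)).factorial : ℂ) ≠ 0 := by exact_mod_cast Nat.factorial_ne_zero _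
  have hsucc : (N : ℂ) + (1 + p) + 1 ≠ 0 := by exact_mod_cast Nat.succ_ne_zero (N + (1 + p))
  simp only [aCoef, bCoef, h₁, h₂, h₃, h₄, Nat.factorial_succ, ← two_mul, pow_mul, Nat.sub_self,
    Nat.factorial_zero]
  push_cast
  field_simp
  norm_num

/-- The explicit projection `∑_L a_{|J ∩ L|} V_L` of `V_J` onto the singular vectors. -/
def projVec (n k : ℕ) (J : Finset (Fin n)) : WT n :=
  ∑ L ∈ Finset.powersetCard k Finset.univ, aCoef n k (J ∩ L).card • Finsupp.single L 1

theorem projVec_apply (n k : ℕ) (J L : Finset (Fin n)) :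
    projVec n k J L = if L.card = k then aCoef n k (J ∩ L).card else 0 := by
  simp [projVec, Finsupp.finsetSum_apply, Finsupp.single_apply]

theorem projVec_mem_sing {n k : ℕ} (hn : 2 * k ≤ n) {J : Finset (Fin n)}
    (hJ : J.card = k) : projVec n k J ∈ sing n k := by
  refine ⟨Submodule.sum_mem _ fun L hL => Submodule.smul_mem _ _
    (single_mem_weight (Finset.mem_powersetCard.1 hL).2), ?_⟩
  rw [SetLike.mem_coe, LinearMap.mem_ker]
  ext K
  rw [opE_apply, Finsupp.zero_apply]
  have hcard : ∀ i ∈ Kᶜ, (insert i K).card = K.card + 1 := fun i hi =>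
    Finset.card_insert_of_notMem (Finset.mem_compl.1 hi)
  by_cases hK : K.card + 1 = k
  · have hsum : ∑ i ∈ Kᶜ, projVec n k J (insert i K) =
        ∑ i ∈ Kᶜ, aCoef n k (J ∩ insert i K).card :=
      Finset.sum_congr rfl fun i hi => by rw [projVec_apply, if_pos ((hcard i hi).trans hK)]
    have hinter : (J ∩ K).card ≤ K.card := Finset.card_le_card Finset.inter_subset_right
    have hsdiff : (J \ K).card = k - (J ∩ K).card := by
      have := Finset.card_sdiff_add_card_inter J K
      omega
    have hcompl : (J ∪ K)ᶜ.card = n - 2 * k + (J ∩ K).card + 1 := by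
      have hunion := Finset.card_union_add_card_inter J K
      rw [Finset.card_compl, Fintype.card_fin]
      omega
    rw [hsum, sum_card_inter_insert, hsdiff, hcompl]
    exact aCoef_recurrence hn (by omega)
  · refine Finset.sum_eq_zero fun i hi => ?_
    rw [projVec_apply, hcard i hi, if_neg hK]

theorem shap_single_eq_shap_projVec {n k : ℕ} (hk : 1 ≤ k) (hn : 2 * k ≤ n)
    {J : Finset (Fin n)} (hJ : J.card = k) {s : WT n} (hs : s ∈ sing n k) :
    shap (Finsupp.single J 1) s = shap (projVec n k J) s := by
  let Φ : WT n →ₗ[ℂ] ℂ := Finsupp.linearCombination ℂ fun K => bCoef n k (J ∩ K).card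
  have hΦ : ∀ x ∈ weight n k,
      Φ (opE n x) = shap (projVec n k J) x - shap (Finsupp.single J 1) x := by
    intro x hx
    induction hx using Submodule.span_induction with
    | zero => simp [shap_eq_sum]
    | add x y _ _ hx hy =>
      simp only [map_add, hx, hy, shap_eq_sum, Finsupp.add_apply, mul_add, Finset.sum_add_distrib]
      ring
    | smul c x _ hx =>
      simp only [map_smul, hx, shap_eq_sum, Finsupp.smul_apply, smul_eq_mul, mul_left_comm _ c,
        ← Finset.mul_sum]
      ring
    | mem x hx =>
      obtain ⟨L, hL, rfl⟩ := hx
      have hsdiff : (L \ J).card = k - (J ∩ L).card := by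
        have := Finset.card_sdiff_add_card_inter L J
        rw [Finset.inter_comm L J] at this
        omega
      have hE : Φ (opE n (Finsupp.single L 1)) = ∑ i ∈ L, bCoef n k (J ∩ L.erase i).card := by
        simp [Φ, opE_single]
      rw [hE, sum_card_inter_erase J L (bCoef n k), hsdiff, shap_comm, shap_single_left,
        shap_single_left, projVec_apply, if_pos hL]
      by_cases hJL : J = L
      · subst hJL
        simp [hJ, bCoef_pred hk hn]
      · have hlt : (J ∩ L).card < k := by
          refine lt_of_le_of_ne (hJ ▸ Finset.card_le_card Finset.inter_subset_left) fun h => hJL ?_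
          have hsub : J ∩ L = J :=
            Finset.eq_of_subset_of_card_le Finset.inter_subset_left (by omega)
          exact Finset.eq_of_subset_of_card_le (Finset.inter_eq_left.1 hsub) (by omega)
        rw [bCoef_recurrence hn hlt, Finsupp.single_eq_of_ne hJL, sub_zero]
  have hzero := hΦ s hs.1
  rw [LinearMap.mem_ker.1 hs.2, map_zero] at hzero
  exact (sub_eq_zero.1 hzero.symm).symm

/-- for `k`-element subsets `I, J` with `|I ∩ J| = ℓ`, one has
`(v_I, v_J) = (v_I, V_J) = a_ℓ`. -/
theorem stmt2 (n k : ℕ) (hk : 1 ≤ k) (hn : 2 * k ≤ n)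
    (π : WT n →ₗ[ℂ] WT n)
    (hrange : ∀ x ∈ weight n k, π x ∈ sing n k)
    (hfix : ∀ x ∈ sing n k, π x = x)
    (horth : ∀ x ∈ weight n k, ∀ s ∈ sing n k, shap (x - π x) s = 0)
    (I J : Finset (Fin n)) (hI : I.card = k) (hJ : J.card = k)
    (ℓ : ℕ) (hℓ : (I ∩ J).card = ℓ) :
    shap (π (Finsupp.single I 1)) (π (Finsupp.single J 1)) = aCoef n k ℓ ∧
    shap (π (Finsupp.single I 1)) (Finsupp.single J 1) = aCoef n k ℓ := by
  have hV : ∀ {L : Finset (Fin n)}, L.card = k → Finsupp.single L 1 ∈ weight n k :=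
    single_mem_weight
  have hpair : shap (π (Finsupp.single I 1)) (Finsupp.single J 1) = aCoef n k ℓ := by
    have horthI := horth _ (hV hI) _ (projVec_mem_sing hn hJ)
    rw [shap_sub_left, sub_eq_zero] at horthI
    rw [shap_comm, shap_single_eq_shap_projVec hk hn hJ (hrange _ (hV hI)), shap_comm, ← horthI,
      shap_single_left, projVec_apply, if_pos hI, Finset.inter_comm, hℓ]
  refine ⟨?_, hpair⟩
  have horthJ := horth _ (hV hJ) _ (hrange _ (hV hI))
  rw [shap_sub_left, sub_eq_zero] at horthJ
  rw [shap_comm, ← horthJ, shap_comm, hpair]
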